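/- arXiv:2208.14350 — 6 statements merged into one kernel-verified Lean document; each statement's English description precedes it below -/
import Mathlib

section
/- Let d ≥ 1 be an integer, L > 0, and let φ : ℝ → (0,∞) be strictly increasing and continuous with log φ uniformly Lipschitz with Lipschitz constant L. Then for all continuous functions w, w' : [0,1]^d → ℝ, the normalized densities satisfy ∫_{[0,1]^d} |φ_w(x) − φ_{w'}(x)| dx ≤ (2 L e^{L‖w−w'‖_∞} φ(‖w'‖_∞) / φ(−‖w'‖_∞)) · ∫_{[0,1]^d} |w(x) − w'(x)| dx. -/
open MeasureTheory Real

noncomputable section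

/-- The unit cube `[0,1]^d`. -/
def cube (d : ℕ) : Set (Fin d → ℝ) := Set.Icc 0 1

/-- Supremum norm of a function over the unit cube. -/
def supNorm (d : ℕ) (w : (Fin d → ℝ) → ℝ) : ℝ :=
  ⨆ x : cube d, |w x.1|

/-- The normalized density `φ_w(x) = φ(w(x)) / ∫_{[0,1]^d} φ(w(x')) dx'`. -/
def phiDens (d : ℕ) (φ : ℝ → ℝ) (w : (Fin d → ℝ) → ℝ) (x : Fin d → ℝ) : ℝ :=
  φ (w x) / ∫ x' in cube d, φ (w x')

lemma isCompact_cube (d : ℕ) : IsCompact (cube d) := isCompact_Icc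

lemma measurableSet_cube (d : ℕ) : MeasurableSet (cube d) := measurableSet_Icc

lemma volume_real_cube (d : ℕ) : volume.real (cube d) = 1 := by
  simp [cube, Measure.real, Real.volume_Icc_pi]

lemma integrableOn_cube {d : ℕ} {f : (Fin d → ℝ) → ℝ} (hf : Continuous f) :
    IntegrableOn f (cube d) :=
  hf.continuousOn.integrableOn_compact (isCompact_cube d)

lemma abs_le_supNorm {d : ℕ} {f : (Fin d → ℝ) → ℝ} (hf : Continuous f) {x : Fin d → ℝ}
    (hx : x ∈ cube d) : |f x| ≤ supNorm d f := by
  have hb : BddAbove (Set.range fun y : cube d => |f y.1|) := by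
    have h := (isCompact_cube d).bddAbove_image hf.abs.continuousOn
    rwa [Set.image_eq_range] at h
  exact le_ciSup hb ⟨x, hx⟩

lemma abs_exp_sub_one_le_mul_exp (t : ℝ) : |exp t - 1| ≤ |t| * exp |t| := by
  rcases le_total 0 t with h | h
  · rw [abs_of_nonneg h, abs_of_nonneg (by linarith [add_one_le_exp t])]
    have h₁ := mul_le_mul_of_nonneg_right (add_one_le_exp (-t)) (exp_pos t).le
    rw [← exp_add, neg_add_cancel, exp_zero] at h₁
    linarith
  · rw [abs_of_nonpos h, abs_of_nonpos (by linarith [exp_le_one_iff.mpr h])]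
    nlinarith [add_one_le_exp t, one_le_exp (neg_nonneg.mpr h)]

/-- Pointwise bound for a positive function whose logarithm is Lipschitz. -/
lemma abs_sub_le_of_log_lipschitz {L : ℝ} {φ : ℝ → ℝ} (hφpos : ∀ z, 0 < φ z)
    (hφlip : ∀ a b, |log (φ a) - log (φ b)| ≤ L * |a - b|) (a b : ℝ) :
    |φ a - φ b| ≤ φ b * (L * |a - b| * exp (L * |a - b|)) := by
  have h : φ a - φ b = φ b * (exp (log (φ a) - log (φ b)) - 1) := by
    rw [exp_sub, exp_log (hφpos a), exp_log (hφpos b)]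
    field_simp [(hφpos b).ne']
  rw [h, abs_mul, abs_of_pos (hφpos b)]
  refine mul_le_mul_of_nonneg_left ((abs_exp_sub_one_le_mul_exp _).trans ?_) (hφpos b).le
  have h₀ := (abs_nonneg _).trans (hφlip a b)
  gcongr <;> exact hφlip a b

/-- Normalizing two nonnegative functions at most doubles their relative `L¹` distance. -/
lemma integral_abs_div_integral_sub_le {α : Type*} [MeasurableSpace α] {μ : Measure α}
    {f g : α → ℝ} (hf : Integrable f μ) (hg : Integrable g μ) (hf₀ : 0 ≤ f)
    (hfpos : 0 < ∫ x, f x ∂μ) (hgpos : 0 < ∫ x, g x ∂μ) :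
    ∫ x, |f x / (∫ y, f y ∂μ) - g x / (∫ y, g y ∂μ)| ∂μ ≤
      2 * (∫ x, |f x - g x| ∂μ) / ∫ x, g x ∂μ := by
  set A := ∫ x, f x ∂μ with hA
  set B := ∫ x, g x ∂μ with hB
  have hAB : |A - B| ≤ ∫ x, |f x - g x| ∂μ := by
    rw [hA, hB, ← integral_sub hf hg]
    exact abs_integral_le_integral_abs
  have hpt (x : α) : |f x / A - g x / B| ≤ |f x - g x| / B + f x * (|A - B| / (A * B)) := by
    have h : f x / A - g x / B = (f x - g x) / B - f x * ((A - B) / (A * B)) := by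
      field_simp
      ring
    rw [h]
    refine (abs_sub _ _).trans_eq ?_
    rw [abs_div, abs_mul, abs_div, abs_of_pos hgpos, abs_of_pos (mul_pos hfpos hgpos),
      abs_of_nonneg (hf₀ x)]
  have hd : Integrable (fun x => |f x - g x|) μ := (hf.sub hg).abs
  calc ∫ x, |f x / A - g x / B| ∂μ
      ≤ ∫ x, (|f x - g x| / B + f x * (|A - B| / (A * B))) ∂μ :=
        integral_mono ((hf.div_const A).sub (hg.div_const B)).abs
          ((hd.div_const B).add (hf.mul_const _)) hpt
    _ = (∫ x, |f x - g x| ∂μ) / B + A * (|A - B| / (A * B)) := by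
        rw [integral_add (hd.div_const B) (hf.mul_const _), integral_div, integral_mul_const]
    _ = ((∫ x, |f x - g x| ∂μ) + |A - B|) / B := by field_simp
    _ ≤ 2 * (∫ x, |f x - g x| ∂μ) / B := by
        gcongr
        linarith

theorem stmt0 (d : ℕ) (hd : 1 ≤ d) (L : ℝ) (hL : 0 < L) (φ : ℝ → ℝ)
    (hφpos : ∀ z, 0 < φ z) (hφmono : StrictMono φ) (hφcont : Continuous φ)
    (hφlip : ∀ a b, |Real.log (φ a) - Real.log (φ b)| ≤ L * |a - b|)
    (w w' : (Fin d → ℝ) → ℝ) (hw : Continuous w) (hw' : Continuous w') :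
    ∫ x in cube d, |phiDens d φ w x - phiDens d φ w' x| ≤
      (2 * L * Real.exp (L * supNorm d (fun x => w x - w' x)) * φ (supNorm d w')
        / φ (-(supNorm d w'))) * ∫ x in cube d, |w x - w' x| := by
  have hfi := integrableOn_cube (hφcont.comp hw)
  have hgi := integrableOn_cube (hφcont.comp hw')
  have hlower {v : (Fin d → ℝ) → ℝ} (hv : Continuous v) :
      φ (-(supNorm d v)) ≤ ∫ x in cube d, φ (v x) := by
    have h := setIntegral_mono_on (integrableOn_cube continuous_const)
      (integrableOn_cube (hφcont.comp hv)) (measurableSet_cube d)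
      fun x hx => hφmono.monotone (neg_le_of_abs_le (abs_le_supNorm hv hx))
    simpa [volume_real_cube] using h
  have hpos {v : (Fin d → ℝ) → ℝ} (hv : Continuous v) : 0 < ∫ x in cube d, φ (v x) :=
    (hφpos _).trans_le (hlower hv)
  set K := L * exp (L * supNorm d (fun x => w x - w' x)) * φ (supNorm d w') with hK
  have hdiff : ∫ x in cube d, |φ (w x) - φ (w' x)| ≤ K * ∫ x in cube d, |w x - w' x| := by
    rw [← integral_const_mul]
    refine setIntegral_mono_on (integrableOn_cube (by fun_prop)) (integrableOn_cube (by fun_prop))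
      (measurableSet_cube d) fun x hx => ?_
    calc |φ (w x) - φ (w' x)|
        ≤ φ (w' x) * (L * |w x - w' x| * exp (L * |w x - w' x|)) :=
          abs_sub_le_of_log_lipschitz hφpos hφlip _ _
      _ ≤ φ (supNorm d w') *
            (L * |w x - w' x| * exp (L * supNorm d (fun x => w x - w' x))) := by
          gcongr
          · exact (hφpos _).le
          · exact hφmono.monotone ((le_abs_self _).trans (abs_le_supNorm hw' hx))
          · exact abs_le_supNorm (hw.sub hw') hx
      _ = K * |w x - w' x| := by rw [hK]; ring
  calc ∫ x in cube d, |phiDens d φ w x - phiDens d φ w' x|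
      ≤ 2 * (∫ x in cube d, |φ (w x) - φ (w' x)|) / ∫ x in cube d, φ (w' x) :=
        integral_abs_div_integral_sub_le hfi hgi (fun x => (hφpos _).le) (hpos hw) (hpos hw')
    _ ≤ 2 * (K * ∫ x in cube d, |w x - w' x|) / φ (-(supNorm d w')) := by
        have h₀ : 0 ≤ ∫ x in cube d, |φ (w x) - φ (w' x)| :=
          integral_nonneg fun x => abs_nonneg _
        have h₁ := hφpos (-(supNorm d w'))
        have h₂ := h₀.trans hdiff
        gcongr
        exact hlower hw'
    _ = _ := by rw [hK]; ring

end
end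

section
/- There exists a universal constant C > 0 with the following property. Let d ≥ 1 be an integer, B > 0, L > 0, and let φ : ℝ → (B,∞) be strictly increasing and uniformly Lipschitz with Lipschitz constant L. Then for all continuous functions w, w' : [0,1]^d → ℝ, both −∫_{[0,1]^d} φ_{w'}(x) log( φ_w(x)/φ_{w'}(x) ) dx and ∫_{[0,1]^d} φ_{w'}(x) ( log( φ_w(x)/φ_{w'}(x) ) )² dx are bounded above by C · (L²/B²) · sup_{x∈[0,1]^d} ( φ_{w'}(x)/φ_w(x) ) · ∫_{[0,1]^d} |w(x) − w'(x)|² dx. -/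
open MeasureTheory

noncomputable section

lemma sq_sub_one_sub_two_log_le {s M : ℝ} (hs : 0 < s) (hM : 1 ≤ M) (h : 1 ≤ M * s ^ 2) :
    s ^ 2 - 1 - 2 * Real.log s ≤ 3 * M * (s - 1) ^ 2 := by
  have hlog := Real.one_sub_inv_le_log_of_pos hs
  have hinv : s⁻¹ ≤ M := by
    rw [inv_le_iff_one_le_mul₀ hs]
    by_contra! hlt
    nlinarith [mul_pos (by linarith : 0 < M) hs]
  have hid : s ^ 2 - 1 - 2 * (1 - s⁻¹) = (1 + 2 * s⁻¹) * (s - 1) ^ 2 := by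
    field_simp
    ring
  calc s ^ 2 - 1 - 2 * Real.log s ≤ s ^ 2 - 1 - 2 * (1 - s⁻¹) := by linarith
    _ = (1 + 2 * s⁻¹) * (s - 1) ^ 2 := hid
    _ ≤ 3 * M * (s - 1) ^ 2 := by gcongr; linarith

lemma log_sq_le {s M : ℝ} (hs : 0 < s) (hM : 1 ≤ M) (h : 1 ≤ M * s ^ 2) :
    Real.log s ^ 2 ≤ M * (s - 1) ^ 2 := by
  have hlow := Real.one_sub_inv_le_log_of_pos hs
  have hup := Real.log_le_sub_one_of_pos hs
  rcases le_total 1 s with h1 | h1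
  · have := Real.log_nonneg h1
    calc Real.log s ^ 2 ≤ (s - 1) ^ 2 := by gcongr
      _ ≤ M * (s - 1) ^ 2 := le_mul_of_one_le_left (sq_nonneg _) hM
  · have hneg := Real.log_nonpos hs.le h1
    have hinv : (s ^ 2)⁻¹ ≤ M := (inv_le_iff_one_le_mul₀ (by positivity)).2 h
    calc Real.log s ^ 2 = (-Real.log s) ^ 2 := by ring
      _ ≤ (s⁻¹ - 1) ^ 2 := pow_le_pow_left₀ (by linarith) (by linarith) 2
      _ = (s ^ 2)⁻¹ * (s - 1) ^ 2 := by field_simp; ring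
      _ ≤ M * (s - 1) ^ 2 := by gcongr

/-- The integrands of the Kullback–Leibler divergence and variation are dominated by that of the
squared Hellinger distance. -/
lemma mul_log_div_le_sq_sqrt_sub {p q M : ℝ} (hp : 0 < p) (hq : 0 < q) (hM : 1 ≤ M)
    (h : q ≤ M * p) :
    -(q * Real.log (p / q)) ≤ 3 * M * (√p - √q) ^ 2 + (q - p) ∧
      q * Real.log (p / q) ^ 2 ≤ 4 * M * (√p - √q) ^ 2 := by
  obtain ⟨a, ha, rfl⟩ : ∃ a, 0 < a ∧ p = a ^ 2 := ⟨√p, by positivity, (Real.sq_sqrt hp.le).symm⟩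
  obtain ⟨b, hb, rfl⟩ : ∃ b, 0 < b ∧ q = b ^ 2 := ⟨√q, by positivity, (Real.sq_sqrt hq.le).symm⟩
  obtain ⟨s, hs, rfl⟩ : ∃ s, 0 < s ∧ a = s * b := ⟨a / b, by positivity, by field_simp⟩
  have hs2 : 1 ≤ M * s ^ 2 := by
    refine le_of_mul_le_mul_right ?_ hq
    linarith
  have hlog : Real.log ((s * b) ^ 2 / b ^ 2) = 2 * Real.log s := by
    rw [show (s * b) ^ 2 / b ^ 2 = s ^ 2 by field_simp, Real.log_pow]
    norm_num
  rw [Real.sqrt_sq ha.le, Real.sqrt_sq hb.le, hlog]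
  have h1 := mul_le_mul_of_nonneg_left (sq_sub_one_sub_two_log_le hs hM hs2) hq.le
  have h2 := mul_le_mul_of_nonneg_left (log_sq_le hs hM hs2) hq.le
  constructor <;> linarith

lemma sq_sqrt_sub_sqrt_le {f g B : ℝ} (hB : 0 < B) (hf : B ≤ f) (hg : B ≤ g) :
    (√f - √g) ^ 2 ≤ (f - g) ^ 2 / (4 * B) := by
  have h1 := Real.sqrt_le_sqrt hf
  have h2 := Real.sqrt_le_sqrt hg
  have hsum : 4 * B ≤ (√f + √g) ^ 2 := by
    calc 4 * B = (√B + √B) ^ 2 := by ring_nf; rw [Real.sq_sqrt hB.le]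
      _ ≤ (√f + √g) ^ 2 := by gcongr
  have hid : (f - g) ^ 2 = (√f - √g) ^ 2 * (√f + √g) ^ 2 := by
    rw [← mul_pow, mul_comm, ← sq_sub_sq, Real.sq_sqrt (hB.le.trans hf),
      Real.sq_sqrt (hB.le.trans hg)]
  rw [le_div_iff₀ (by positivity), hid]
  gcongr

section Integral

variable {X : Type*} [MeasurableSpace X] {μ : Measure X}

/-- Normalizing two unnormalized densities changes their squared Hellinger distance by at most the
factor `1 / √(∫ f * ∫ g)`. -/
lemma integral_sq_sqrt_normalized_sub_le {f g : X → ℝ} (hf : Integrable f μ) (hg : Integrable g μ)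
    (hfg : Integrable (fun x => √(f x) * √(g x)) μ) (hf0 : ∀ x, 0 ≤ f x) (hg0 : ∀ x, 0 ≤ g x)
    (hZf : 0 < ∫ x, f x ∂μ) (hZg : 0 < ∫ x, g x ∂μ) :
    ∫ x, (√(f x / ∫ y, f y ∂μ) - √(g x / ∫ y, g y ∂μ)) ^ 2 ∂μ ≤
      (∫ x, (√(f x) - √(g x)) ^ 2 ∂μ) / (√(∫ x, f x ∂μ) * √(∫ x, g x ∂μ)) := by
  set S := ∫ x, f x ∂μ with hS
  set T := ∫ x, g x ∂μ with hT
  have hsq : ∀ x, (√(f x) - √(g x)) ^ 2 = f x + g x - 2 * (√(f x) * √(g x)) := fun x => by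
    rw [sub_sq, Real.sq_sqrt (hf0 x), Real.sq_sqrt (hg0 x)]
    ring
  have hsq' : ∀ x, (√(f x / S) - √(g x / T)) ^ 2 =
      f x / S + g x / T - 2 / (√S * √T) * (√(f x) * √(g x)) := fun x => by
    rw [sub_sq, Real.sq_sqrt (div_nonneg (hf0 x) hZf.le), Real.sq_sqrt (div_nonneg (hg0 x) hZg.le),
      Real.sqrt_div (hf0 x), Real.sqrt_div (hg0 x)]
    ring
  have hadd : Integrable (fun x => f x + g x) μ := hf.add hg
  have hadd' : Integrable (fun x => f x / S + g x / T) μ := (hf.div_const S).add (hg.div_const T)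
  simp_rw [hsq, hsq']
  rw [integral_sub hadd' (hfg.const_mul _), integral_add (hf.div_const S) (hg.div_const T),
    integral_sub hadd (hfg.const_mul _),
    integral_add hf hg, integral_const_mul, integral_const_mul, integral_div, integral_div,
    ← hS, ← hT, div_self hZf.ne', div_self hZg.ne']
  have hS' := Real.sqrt_pos.2 hZf
  have hT' := Real.sqrt_pos.2 hZg
  rw [le_div_iff₀ (by positivity)]
  have hcancel : 2 / (√S * √T) * (∫ x, √(f x) * √(g x) ∂μ) * (√S * √T) =
      2 * ∫ x, √(f x) * √(g x) ∂μ := by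
    field_simp
  rw [sub_mul, hcancel]
  nlinarith [sq_nonneg (√S - √T), Real.sq_sqrt hZf.le, Real.sq_sqrt hZg.le]

end Integral

lemma isProbabilityMeasure_restrict_cube (d : ℕ) :
    IsProbabilityMeasure ((volume : Measure (Fin d → ℝ)).restrict (cube d)) :=
  ⟨by simp [cube, Real.volume_Icc_pi]⟩

lemma integrable_cube {d : ℕ} {f : (Fin d → ℝ) → ℝ} (hf : Continuous f) :
    Integrable f (volume.restrict (cube d)) :=
  hf.integrableOn_Icc

theorem stmt4 :
    ∃ C : ℝ, 0 < C ∧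
      ∀ (d : ℕ), 1 ≤ d → ∀ (B L : ℝ), 0 < B → 0 < L →
        ∀ φ : ℝ → ℝ, (∀ z, B < φ z) → StrictMono φ →
          (∀ a b, |φ a - φ b| ≤ L * |a - b|) →
          ∀ w w' : (Fin d → ℝ) → ℝ, Continuous w → Continuous w' →
            (-(∫ x in cube d, phiDens d φ w' x *
                  Real.log (phiDens d φ w x / phiDens d φ w' x)) ≤
                C * (L ^ 2 / B ^ 2) *
                  (⨆ x : cube d, phiDens d φ w' x.1 / phiDens d φ w x.1) *
                  ∫ x in cube d, |w x - w' x| ^ 2) ∧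
            ((∫ x in cube d, phiDens d φ w' x *
                  (Real.log (phiDens d φ w x / phiDens d φ w' x)) ^ 2) ≤
                C * (L ^ 2 / B ^ 2) *
                  (⨆ x : cube d, phiDens d φ w' x.1 / phiDens d φ w x.1) *
                  ∫ x in cube d, |w x - w' x| ^ 2) := by
  refine ⟨1, one_pos, ?_⟩
  intro d _ B L hB hL φ hφB _ hφL w w' hw hw'
  have hprob := isProbabilityMeasure_restrict_cube d
  have hφ : Continuous φ :=
    (LipschitzWith.of_dist_le_mul (K := ⟨L, hL.le⟩) fun a b => hφL a b).continuous
  have hZ : ∀ v : (Fin d → ℝ) → ℝ, Continuous v → B ≤ ∫ x in cube d, φ (v x) := fun v hv => by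
    have := integral_mono (integrable_const B) (integrable_cube (hφ.comp hv))
      fun x => (hφB (v x)).le
    simpa using this
  have hcont : ∀ v : (Fin d → ℝ) → ℝ, Continuous v → Continuous (phiDens d φ v) := fun v hv =>
    (hφ.comp hv).div_const _
  have hpos : ∀ v : (Fin d → ℝ) → ℝ, Continuous v → ∀ x, 0 < phiDens d φ v x := fun v hv x =>
    div_pos (hB.trans (hφB _)) (hB.trans_le (hZ v hv))
  have hone : ∀ v : (Fin d → ℝ) → ℝ, Continuous v → ∫ x in cube d, phiDens d φ v x = 1 :=
    fun v hv => by
      simp only [phiDens]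
      rw [integral_div, div_self (hB.trans_le (hZ v hv)).ne']
  have hhell : ∫ x in cube d, (√(phiDens d φ w x) - √(phiDens d φ w' x)) ^ 2 ≤
      L ^ 2 / (4 * B ^ 2) * ∫ x in cube d, |w x - w' x| ^ 2 := by
    have hBZ : B ≤ √(∫ x in cube d, φ (w x)) * √(∫ x in cube d, φ (w' x)) := by
      calc B = √B * √B := (Real.mul_self_sqrt hB.le).symm
        _ ≤ _ := mul_le_mul (Real.sqrt_le_sqrt (hZ w hw)) (Real.sqrt_le_sqrt (hZ w' hw'))
          (by positivity) (by positivity)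
    have hle : ∫ x in cube d, (√(φ (w x)) - √(φ (w' x))) ^ 2 ≤
        L ^ 2 / (4 * B) * ∫ x in cube d, |w x - w' x| ^ 2 := by
      rw [← integral_const_mul]
      refine integral_mono (integrable_cube (by fun_prop)) (integrable_cube (by fun_prop))
        fun x => ?_
      calc (√(φ (w x)) - √(φ (w' x))) ^ 2 ≤ (φ (w x) - φ (w' x)) ^ 2 / (4 * B) :=
            sq_sqrt_sub_sqrt_le hB (hφB _).le (hφB _).le
        _ = |φ (w x) - φ (w' x)| ^ 2 / (4 * B) := by rw [sq_abs]
        _ ≤ (L * |w x - w' x|) ^ 2 / (4 * B) := by gcongr; exact hφL _ _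
        _ = L ^ 2 / (4 * B) * |w x - w' x| ^ 2 := by ring
    calc ∫ x in cube d, (√(phiDens d φ w x) - √(phiDens d φ w' x)) ^ 2
        ≤ (∫ x in cube d, (√(φ (w x)) - √(φ (w' x))) ^ 2) /
          (√(∫ x in cube d, φ (w x)) * √(∫ x in cube d, φ (w' x))) :=
          integral_sq_sqrt_normalized_sub_le (f := fun x => φ (w x)) (g := fun x => φ (w' x))
            (integrable_cube (by fun_prop)) (integrable_cube (by fun_prop))
            (integrable_cube (by fun_prop)) (fun x => (hB.trans (hφB _)).le)
            (fun x => (hB.trans (hφB _)).le) (hB.trans_le (hZ w hw)) (hB.trans_le (hZ w' hw'))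
      _ ≤ (∫ x in cube d, (√(φ (w x)) - √(φ (w' x))) ^ 2) / B := by
          gcongr
      _ ≤ (L ^ 2 / (4 * B) * ∫ x in cube d, |w x - w' x| ^ 2) / B := by gcongr
      _ = L ^ 2 / (4 * B ^ 2) * ∫ x in cube d, |w x - w' x| ^ 2 := by field_simp
  have hp := hcont w hw
  have hq := hcont w' hw'
  have hp0 := hpos w hw
  have hq0 := hpos w' hw'
  have hp1 := hone w hw
  have hq1 := hone w' hw'
  generalize phiDens d φ w = p at *
  generalize phiDens d φ w' = q at *
  set M := ⨆ x : cube d, q x.1 / p x.1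
  have hbdd : BddAbove (Set.range fun x : cube d => q x.1 / p x.1) := by
    have hcpt : IsCompact (cube d) := isCompact_Icc
    have := (hcpt.image (hq.div hp fun x => (hp0 x).ne')).bddAbove
    rwa [Set.image_eq_range] at this
  have hqM : ∀ x ∈ cube d, q x ≤ M * p x := fun x hx =>
    (div_le_iff₀ (hp0 x)).1 (le_ciSup hbdd ⟨x, hx⟩)
  have hmeas : MeasurableSet (cube d) := measurableSet_Icc
  have hM1 : 1 ≤ M := by
    have := setIntegral_mono_on (integrable_cube hq) (integrable_cube (hp.const_mul M)) hmeas hqM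
    rwa [integral_const_mul, hp1, hq1, mul_one] at this
  have hlog : Continuous fun x => Real.log (p x / q x) :=
    (hp.div hq fun x => (hq0 x).ne').log fun x => (div_pos (hp0 x) (hq0 x)).ne'
  have hM0 : 0 ≤ M := zero_le_one.trans hM1
  constructor
  · calc -(∫ x in cube d, q x * Real.log (p x / q x))
        = ∫ x in cube d, -(q x * Real.log (p x / q x)) := (integral_neg _).symm
      _ ≤ ∫ x in cube d, (3 * M * (√(p x) - √(q x)) ^ 2 + (q x - p x)) :=
          setIntegral_mono_on (integrable_cube (by fun_prop)) (integrable_cube (by fun_prop)) hmeas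
            fun x hx => (mul_log_div_le_sq_sqrt_sub (hp0 x) (hq0 x) hM1 (hqM x hx)).1
      _ = 3 * M * ∫ x in cube d, (√(p x) - √(q x)) ^ 2 := by
          rw [integral_add (integrable_cube (by fun_prop)) (integrable_cube (by fun_prop)),
            integral_sub (integrable_cube hq) (integrable_cube hp), integral_const_mul, hp1, hq1]
          ring
      _ ≤ 4 * M * (L ^ 2 / (4 * B ^ 2) * ∫ x in cube d, |w x - w' x| ^ 2) := by
          gcongr
          norm_num
      _ = 1 * (L ^ 2 / B ^ 2) * M * ∫ x in cube d, |w x - w' x| ^ 2 := by field_simp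
  · calc ∫ x in cube d, q x * Real.log (p x / q x) ^ 2
        ≤ ∫ x in cube d, 4 * M * (√(p x) - √(q x)) ^ 2 :=
          setIntegral_mono_on (integrable_cube (by fun_prop)) (integrable_cube (by fun_prop)) hmeas
            fun x hx => (mul_log_div_le_sq_sqrt_sub (hp0 x) (hq0 x) hM1 (hqM x hx)).2
      _ = 4 * M * ∫ x in cube d, (√(p x) - √(q x)) ^ 2 := integral_const_mul _ _
      _ ≤ 4 * M * (L ^ 2 / (4 * B ^ 2) * ∫ x in cube d, |w x - w' x| ^ 2) := by gcongr
      _ = 1 * (L ^ 2 / B ^ 2) * M * ∫ x in cube d, |w x - w' x| ^ 2 := by field_simp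

end
end

section
/- Let d, s₀, M be real numbers with d > 0, s₀ > 0, M > 0. For a real number n > 1 set s* = s₀ · log n / (M + log n) and c₁ = exp( 2 d M s₀ / (2s₀+d)² ). Then: (i) n^{d/(2s*+d)} = n^{d/(2s₀+d)} · exp( 2 d M s₀ · log n / ( (2s₀+d)² log n + d M (2s₀+d) ) ); (ii) for every n > 1, n^{d/(2s*+d)} ≤ c₁ · n^{d/(2s₀+d)}; (iii) there exists N such that for all n ≥ N, n^{d/(2s*+d)} ≥ √c₁ · n^{d/(2s₀+d)}. -/
theorem rpow_effective_smoothness_eq {d s₀ M n : ℝ} (hd : 0 < d) (hs₀ : 0 < s₀) (hM : 0 < M)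
    (hn : 1 < n) :
    n ^ (d / (2 * (s₀ * Real.log n / (M + Real.log n)) + d)) =
      n ^ (d / (2 * s₀ + d)) *
        Real.exp (2 * d * M * s₀ * Real.log n /
          ((2 * s₀ + d) ^ 2 * Real.log n + d * M * (2 * s₀ + d))) := by
  have hL : 0 < Real.log n := Real.log_pos hn
  have hn0 : 0 < n := by linarith
  rw [Real.rpow_def_of_pos hn0, Real.rpow_def_of_pos hn0, ← Real.exp_add]
  congr 1
  generalize Real.log n = L at hL ⊢
  have h₁ : 2 * (s₀ * L / (M + L)) + d = ((2 * s₀ + d) * L + d * M) / (M + L) := by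
    field_simp
    ring
  have h₂ : (2 * s₀ + d) ^ 2 * L + d * M * (2 * s₀ + d) =
      (2 * s₀ + d) * ((2 * s₀ + d) * L + d * M) := by ring
  have h₃ : 0 < (2 * s₀ + d) * L + d * M := by positivity
  have h₄ : 0 < 2 * s₀ + d := by positivity
  rw [h₁, h₂]
  field_simp
  ring

theorem stmt8 (d s₀ M : ℝ) (hd : 0 < d) (hs₀ : 0 < s₀) (hM : 0 < M) :
    (∀ n : ℝ, 1 < n →
      n ^ (d / (2 * (s₀ * Real.log n / (M + Real.log n)) + d)) =
        n ^ (d / (2 * s₀ + d)) *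
          Real.exp (2 * d * M * s₀ * Real.log n /
            ((2 * s₀ + d) ^ 2 * Real.log n + d * M * (2 * s₀ + d)))) ∧
    (∀ n : ℝ, 1 < n →
      n ^ (d / (2 * (s₀ * Real.log n / (M + Real.log n)) + d)) ≤
        Real.exp (2 * d * M * s₀ / (2 * s₀ + d) ^ 2) * n ^ (d / (2 * s₀ + d))) ∧
    (∃ N : ℝ, ∀ n : ℝ, N ≤ n →
      Real.sqrt (Real.exp (2 * d * M * s₀ / (2 * s₀ + d) ^ 2)) *
          n ^ (d / (2 * s₀ + d)) ≤
        n ^ (d / (2 * (s₀ * Real.log n / (M + Real.log n)) + d))) := by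
  refine ⟨fun n hn => rpow_effective_smoothness_eq hd hs₀ hM hn, fun n hn => ?_,
    Real.exp (d * M / (2 * s₀ + d)), fun n hN => ?_⟩
  · have hL : 0 < Real.log n := Real.log_pos hn
    rw [rpow_effective_smoothness_eq hd hs₀ hM hn, mul_comm]
    refine mul_le_mul_of_nonneg_right (Real.exp_le_exp.mpr ?_) (by positivity)
    rw [div_le_div_iff₀ (by positivity) (by positivity)]
    have : 0 ≤ 2 * d * M * s₀ * (d * M * (2 * s₀ + d)) := by positivity
    linarith
  · have hn : 1 < n := (Real.one_lt_exp_iff.mpr (by positivity)).trans_le hN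
    have hL : 0 < Real.log n := Real.log_pos hn
    have hLN : d * M ≤ Real.log n * (2 * s₀ + d) :=
      (div_le_iff₀ (by positivity)).mp ((Real.le_log_iff_exp_le (by linarith)).mpr hN)
    rw [rpow_effective_smoothness_eq hd hs₀ hM hn, ← Real.exp_half, mul_comm]
    refine mul_le_mul_of_nonneg_left (Real.exp_le_exp.mpr ?_) (by positivity)
    rw [div_div, div_le_div_iff₀ (by positivity) (by positivity)]
    have := mul_le_mul_of_nonneg_left hLN
      (by positivity : 0 ≤ 2 * d * M * s₀ * (2 * s₀ + d))
    linarith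
end

section
/- Let d, s*, s, n be real numbers with d > 0, s* > d, s* ≤ s < s* + d and n ≥ 1. Then n^{ −d s / ( (2s+d)(s*+d−s) ) } · n^{ d/(2s*+d) } ≤ n^{ −s*/(2s*+d) } · n^{ d/(2s+d) }. -/
theorem stmt9 (d sstar s n : ℝ) (hd : 0 < d) (hsstar : d < sstar)
    (hs1 : sstar ≤ s) (hs2 : s < sstar + d) (hn : 1 ≤ n) :
    n ^ (-(d * s / ((2 * s + d) * (sstar + d - s)))) * n ^ (d / (2 * sstar + d)) ≤
      n ^ (-(sstar / (2 * sstar + d))) * n ^ (d / (2 * s + d)) := by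
  have hn0 : 0 < n := by linarith
  rw [← Real.rpow_add hn0, ← Real.rpow_add hn0]
  apply Real.rpow_le_rpow_of_exponent_le hn
  have hu : 0 < sstar + d - s := by linarith
  have hs : 0 < 2 * s + d := by linarith
  have ht : 0 < 2 * sstar + d := by linarith
  have key : (-(sstar / (2 * sstar + d)) + d / (2 * s + d)) -
      (-(d * s / ((2 * s + d) * (sstar + d - s))) + d / (2 * sstar + d)) =
      (s - sstar) * (sstar + d) * (2 * s - d) /
        ((2 * s + d) * (sstar + d - s) * (2 * sstar + d)) := by
    have hu0 := hu.ne'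
    have hs0 := hs.ne'
    have ht0 := ht.ne'
    rw [← neg_div, ← neg_div, div_add_div _ _ ht0 hs0,
      div_add_div _ _ (mul_ne_zero hs0 hu0) ht0,
      div_sub_div _ _ (by positivity) (by positivity),
      div_eq_div_iff (by positivity) (by positivity)]
    ring
  have h1 : 0 ≤ s - sstar := by linarith
  have h2 : 0 ≤ sstar + d := by linarith
  have h3 : 0 ≤ 2 * s - d := by linarith
  rw [← sub_nonneg, key]
  positivity
end

section
/- Let d ≥ 1 be an integer, L > 0, R > 0, and let φ : ℝ → (0,∞) be strictly increasing and continuous with log φ uniformly Lipschitz with Lipschitz constant L. Then there exists a constant C > 0, depending only on d, L, R and φ, such that for all continuous functions w, w' : [0,1]^d → ℝ with ‖w‖_∞ ≤ R and ‖w'‖_∞ ≤ R, the normalized densities satisfy ( ∫_{[0,1]^d} |φ_w(x) − φ_{w'}(x)|² dx )^{1/2} ≤ C ( ∫_{[0,1]^d} |w(x) − w'(x)|² dx )^{1/2}. -/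
open MeasureTheory

noncomputable section

lemma isProbabilityMeasure_restrict_cube_s13 (d : ℕ) :
    IsProbabilityMeasure (volume.restrict (cube d)) := by
  constructor
  simp [cube, Real.volume_Icc_pi]

lemma abs_le_of_supNorm_le {d : ℕ} {w : (Fin d → ℝ) → ℝ} {R : ℝ} (hw : Continuous w)
    (h : supNorm d w ≤ R) {x : Fin d → ℝ} (hx : x ∈ cube d) : |w x| ≤ R := by
  have hb : BddAbove (Set.range fun x : cube d => |w x.1|) := by
    have hc : IsCompact ((fun x => |w x|) '' cube d) :=
      (isCompact_Icc (a := (0 : Fin d → ℝ)) (b := 1)).image hw.abs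
    refine hc.bddAbove.mono ?_
    rintro _ ⟨y, rfl⟩
    exact ⟨y.1, y.2, rfl⟩
  exact (le_ciSup hb ⟨x, hx⟩).trans h

lemma sub_le_mul_log_sub_log {a b M : ℝ} (ha : 0 < a) (hb : 0 < b) (haM : a ≤ M) :
    a - b ≤ M * |Real.log a - Real.log b| := by
  have h1 : a - b ≤ a * (Real.log a - Real.log b) := by
    have h2 := Real.log_le_sub_one_of_pos (div_pos hb ha)
    rw [Real.log_div hb.ne' ha.ne'] at h2
    have h3 := mul_le_mul_of_nonneg_left h2 ha.le
    have h4 : a * (b / a - 1) = b - a := by field_simp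
    linarith
  calc a - b ≤ a * (Real.log a - Real.log b) := h1
    _ ≤ a * |Real.log a - Real.log b| := by gcongr; exact le_abs_self _
    _ ≤ M * |Real.log a - Real.log b| := by gcongr

lemma abs_sub_le_mul_abs_log_sub_log {a b M : ℝ} (ha : 0 < a) (hb : 0 < b)
    (haM : a ≤ M) (hbM : b ≤ M) : |a - b| ≤ M * |Real.log a - Real.log b| := by
  refine abs_le.2 ⟨?_, sub_le_mul_log_sub_log ha hb haM⟩
  have := sub_le_mul_log_sub_log hb ha hbM
  rw [abs_sub_comm] at this
  linarith

lemma sq_integral_le_integral_sq {α : Type*} [MeasurableSpace α] {μ : Measure α}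
    [IsProbabilityMeasure μ] {h : α → ℝ} (hi : Integrable h μ)
    (hi2 : Integrable (fun x => h x ^ 2) μ) : (∫ x, h x ∂μ) ^ 2 ≤ ∫ x, h x ^ 2 ∂μ := by
  set A := ∫ x, h x ∂μ with hA
  have h0 : 0 ≤ ∫ x, (h x ^ 2 - 2 * A * h x + A ^ 2) ∂μ :=
    integral_nonneg fun x => by
      have := sq_nonneg (h x - A)
      simp only [Pi.zero_apply]
      nlinarith
  have hi3 : Integrable (fun x => h x ^ 2 - 2 * A * h x) μ := hi2.sub (hi.const_mul _)
  rw [integral_add hi3 (integrable_const _), integral_sub hi2 (hi.const_mul _), integral_const_mul, ← hA] at h0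
  simp at h0
  nlinarith

/-- Elementary bound for the squared difference of two normalized quantities. -/
lemma sq_abs_div_sub_div_le {f g I J m M u v : ℝ} (hm : 0 < m) (hI : m ≤ I) (hJ : m ≤ J)
    (hg : 0 ≤ g) (hgM : g ≤ M) (hfg : |f - g| ≤ u) (hIJ : |I - J| ≤ v) :
    |f / I - g / J| ^ 2 ≤ 2 / m ^ 2 * u ^ 2 + 2 * M ^ 2 / m ^ 4 * v ^ 2 := by
  have hI0 := hm.trans_le hI
  have hJ0 := hm.trans_le hJ
  have hM : 0 ≤ M := hg.trans hgM
  have hv : 0 ≤ v := (abs_nonneg _).trans hIJ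
  have hu : 0 ≤ u := (abs_nonneg _).trans hfg
  have h1 : f / I - g / J = (f - g) / I - g * (I - J) / (I * J) := by
    field_simp
    ring
  have h2 : |f / I - g / J| ≤ u / m + M * v / (m * m) := by
    rw [h1]
    refine (abs_sub _ _).trans (add_le_add ?_ ?_)
    · rw [abs_div, abs_of_pos hI0]
      gcongr
    · rw [abs_div, abs_mul, abs_of_pos (mul_pos hI0 hJ0), abs_of_nonneg hg]
      gcongr
  calc |f / I - g / J| ^ 2 ≤ (u / m + M * v / (m * m)) ^ 2 := by gcongr
    _ ≤ 2 * ((u / m) ^ 2 + (M * v / (m * m)) ^ 2) := add_sq_le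
    _ = _ := by
      field_simp

theorem stmt13 (d : ℕ) (hd : 1 ≤ d) (L R : ℝ) (hL : 0 < L) (hR : 0 < R)
    (φ : ℝ → ℝ) (hφpos : ∀ z, 0 < φ z) (hφmono : StrictMono φ)
    (hφcont : Continuous φ)
    (hφlip : ∀ a b, |Real.log (φ a) - Real.log (φ b)| ≤ L * |a - b|) :
    ∃ C : ℝ, 0 < C ∧
      ∀ w w' : (Fin d → ℝ) → ℝ, Continuous w → Continuous w' →
        supNorm d w ≤ R → supNorm d w' ≤ R →
        Real.sqrt (∫ x in cube d, |phiDens d φ w x - phiDens d φ w' x| ^ 2) ≤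
          C * Real.sqrt (∫ x in cube d, |w x - w' x| ^ 2) := by
  have := isProbabilityMeasure_restrict_cube_s13 d
  have hint : ∀ {f : (Fin d → ℝ) → ℝ}, Continuous f → IntegrableOn f (cube d) :=
    fun hf => hf.continuousOn.integrableOn_compact isCompact_Icc
  have hmeas : MeasurableSet (cube d) := measurableSet_Icc
  set m := φ (-R)
  set M := φ R
  have hm : 0 < m := hφpos _
  have hM : 0 < M := hφpos _
  set K := M * L
  have hK : 0 < K := mul_pos hM hL
  set D := 2 / m ^ 2 * K ^ 2 + 2 * M ^ 2 / m ^ 4 * K ^ 2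
  have hD : 0 < D := by positivity
  refine ⟨Real.sqrt D, Real.sqrt_pos.2 hD, fun w w' hw hw' hwR hwR' => ?_⟩
  rw [← Real.sqrt_mul hD.le]
  apply Real.sqrt_le_sqrt
  have hbd : ∀ {v : (Fin d → ℝ) → ℝ}, Continuous v → supNorm d v ≤ R →
      ∀ x ∈ cube d, m ≤ φ (v x) ∧ φ (v x) ≤ M := fun hv hvR x hx => by
    have h := abs_le.1 (abs_le_of_supNorm_le hv hvR hx)
    exact ⟨hφmono.monotone h.1, hφmono.monotone h.2⟩
  have hlow : ∀ {v : (Fin d → ℝ) → ℝ}, Continuous v → supNorm d v ≤ R →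
      m ≤ ∫ x in cube d, φ (v x) := fun hv hvR => by
    have h := setIntegral_mono_on (hint (continuous_const (y := m)))
      (hint (hφcont.comp hv)) hmeas fun x hx => (hbd hv hvR x hx).1
    simpa using h
  have hpt : ∀ x ∈ cube d, |φ (w x) - φ (w' x)| ≤ K * |w x - w' x| := fun x hx =>
    calc |φ (w x) - φ (w' x)| ≤ M * |Real.log (φ (w x)) - Real.log (φ (w' x))| :=
          abs_sub_le_mul_abs_log_sub_log (hφpos _) (hφpos _) (hbd hw hwR x hx).2
            (hbd hw' hwR' x hx).2
      _ ≤ M * (L * |w x - w' x|) := by gcongr; exact hφlip _ _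
      _ = K * |w x - w' x| := by ring
  have hcd : Continuous fun x => |w x - w' x| := (hw.sub hw').abs
  set A := ∫ x in cube d, |w x - w' x|
  have hIJ : |(∫ x in cube d, φ (w x)) - ∫ x in cube d, φ (w' x)| ≤ K * A := by
    have hφw : IntegrableOn (fun x => φ (w x)) (cube d) := hint (hφcont.comp hw)
    have hφw' : IntegrableOn (fun x => φ (w' x)) (cube d) := hint (hφcont.comp hw')
    rw [← integral_sub hφw hφw']
    refine (abs_integral_le_integral_abs).trans ?_
    rw [← integral_const_mul]
    exact setIntegral_mono_on (hint ((hφcont.comp hw).sub (hφcont.comp hw')).abs)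
      (hint (hcd.const_mul K)) hmeas hpt
  have hA : A ^ 2 ≤ ∫ x in cube d, |w x - w' x| ^ 2 :=
    sq_integral_le_integral_sq (hint hcd) (hint (hcd.pow 2))
  calc ∫ x in cube d, |phiDens d φ w x - phiDens d φ w' x| ^ 2
      ≤ ∫ x in cube d, (2 / m ^ 2 * K ^ 2 * |w x - w' x| ^ 2
          + 2 * M ^ 2 / m ^ 4 * (K * A) ^ 2) := by
        refine setIntegral_mono_on
          (hint ((((hφcont.comp hw).div_const _).sub ((hφcont.comp hw').div_const _)).abs.pow 2))
          (hint (((hcd.pow 2).const_mul _).add continuous_const)) hmeas fun x hx => ?_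
        have h := sq_abs_div_sub_div_le hm (hlow hw hwR) (hlow hw' hwR') (hφpos _).le
          (hbd hw' hwR' x hx).2 (hpt x hx) hIJ
        rw [mul_pow K |w x - w' x|, ← mul_assoc] at h
        exact h
    _ = 2 / m ^ 2 * K ^ 2 * (∫ x in cube d, |w x - w' x| ^ 2)
          + 2 * M ^ 2 / m ^ 4 * K ^ 2 * A ^ 2 := by
        have hi : IntegrableOn (fun x => 2 / m ^ 2 * K ^ 2 * |w x - w' x| ^ 2) (cube d) :=
          hint ((hcd.pow 2).const_mul _)
        rw [integral_add hi (integrable_const _), integral_const_mul]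
        simp
        ring
    _ ≤ 2 / m ^ 2 * K ^ 2 * (∫ x in cube d, |w x - w' x| ^ 2)
          + 2 * M ^ 2 / m ^ 4 * K ^ 2 * ∫ x in cube d, |w x - w' x| ^ 2 := by gcongr
    _ = D * ∫ x in cube d, |w x - w' x| ^ 2 := by ring

end
end

section
/- Let d ≥ 1 be an integer. Then there exist constants 0 < c ≤ C and N ≥ 3 such that for all real n ≥ N, c · log n ≤ ∫_d^{log n} exp( − n^{d/(2s+d)} ) ds ≤ C · log n. -/
/-- The unnormalised hyper-prior density is interval integrable on nonnegative intervals. -/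
theorem intervalIntegrable_exp_neg_rpow_div {d n a b : ℝ} (hd : 0 < d) (hn : 0 < n)
    (ha : 0 ≤ a) (hab : a ≤ b) :
    IntervalIntegrable (fun s : ℝ => Real.exp (-(n ^ (d / (2 * s + d)))))
      MeasureTheory.volume a b := by
  apply ContinuousOn.intervalIntegrable
  rw [Set.uIcc_of_le hab]
  refine (ContinuousOn.neg (ContinuousOn.rpow continuousOn_const ?_ ?_)).rexp
  · refine continuousOn_const.div (by fun_prop) fun s hs => ?_
    have hs0 : 0 ≤ s := ha.trans hs.1
    positivity
  · exact fun _ _ => Or.inl hn.ne'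

theorem rpow_div_le_exp {d n s : ℝ} (hd : 0 < d) (hn : 1 ≤ n) (hs : Real.log n / 2 ≤ s) :
    n ^ (d / (2 * s + d)) ≤ Real.exp d := by
  have hlog : 0 ≤ Real.log n := Real.log_nonneg hn
  rw [Real.rpow_def_of_pos (by linarith), Real.exp_le_exp, ← mul_div_assoc,
    div_le_iff₀ (by linarith)]
  nlinarith

theorem stmt15 (d : ℕ) (hd : 1 ≤ d) :
    ∃ c C N : ℝ, 0 < c ∧ c ≤ C ∧ 3 ≤ N ∧
      ∀ n : ℝ, N ≤ n →
        c * Real.log n ≤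
            (∫ s in (d : ℝ)..(Real.log n),
              Real.exp (-(n ^ ((d : ℝ) / (2 * s + (d : ℝ)))))) ∧
          (∫ s in (d : ℝ)..(Real.log n),
              Real.exp (-(n ^ ((d : ℝ) / (2 * s + (d : ℝ)))))) ≤
            C * Real.log n := by
  have hd1 : (1 : ℝ) ≤ d := by exact_mod_cast hd
  have hd0 : (0 : ℝ) < d := by linarith
  refine ⟨Real.exp (-Real.exp d) / 2, 1, Real.exp (2 * d), by positivity, ?_, ?_, ?_⟩
  · have : Real.exp (-Real.exp d) ≤ 1 := Real.exp_le_one_iff.2 (by linarith [Real.exp_pos (d : ℝ)])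
    linarith
  · linarith [Real.add_one_le_exp (2 * (d : ℝ))]
  intro n hN
  have hn0 : 0 < n := (Real.exp_pos _).trans_le hN
  have hL : 2 * (d : ℝ) ≤ Real.log n := (Real.le_log_iff_exp_le hn0).2 hN
  have hn1 : 1 ≤ n := (Real.one_le_exp (by positivity)).trans hN
  constructor
  · have hfst := intervalIntegrable_exp_neg_rpow_div (a := d) (b := Real.log n / 2) hd0 hn0
      hd0.le (by linarith)
    have hsnd := intervalIntegrable_exp_neg_rpow_div (a := Real.log n / 2) (b := Real.log n)
      hd0 hn0 (by linarith) (by linarith)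
    rw [← intervalIntegral.integral_add_adjacent_intervals hfst hsnd]
    have hnonneg : 0 ≤ ∫ s in (d : ℝ)..(Real.log n / 2),
        Real.exp (-(n ^ ((d : ℝ) / (2 * s + (d : ℝ))))) :=
      intervalIntegral.integral_nonneg (by linarith) fun _ _ => (Real.exp_pos _).le
    have hle := intervalIntegral.integral_mono_on (by linarith)
      (intervalIntegrable_const (c := Real.exp (-Real.exp d))) hsnd
      fun s hs => Real.exp_le_exp.2 (neg_le_neg (rpow_div_le_exp hd0 hn1 hs.1))
    rw [intervalIntegral.integral_const, smul_eq_mul] at hle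
    linarith
  · have hle := intervalIntegral.integral_mono_on (by linarith)
      (intervalIntegrable_exp_neg_rpow_div (a := d) (b := Real.log n) hd0 hn0 hd0.le (by linarith))
      (intervalIntegrable_const (c := (1 : ℝ)))
      fun s _ => Real.exp_le_one_iff.2 (neg_nonpos.2 (Real.rpow_nonneg hn0.le _))
    rw [intervalIntegral.integral_const, smul_eq_mul] at hle
    linarith
end
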